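/- For the hyperbolic polynomial P(x,t) = x² − (t₁² + t₂²) with parameters t = (t₁,t₂) ∈ ℝ², and any z ∈ ℂ with small |z|: for every complex parameter τ = (τ₁,τ₂) ∈ ℂ² with τ₁² + τ₂² = z², one has dist(τ, ℝ²) ≥ |Im z|, where dist(τ, ℝ²)² = (Im τ₁)² + (Im τ₂)². -/

import Mathlib

theorem stmt19 (z τ₁ τ₂ : ℂ) (h : τ₁ ^ 2 + τ₂ ^ 2 = z ^ 2) :
    |z.im| ≤ Real.sqrt (τ₁.im ^ 2 + τ₂.im ^ 2) := by
  have hr := congrArg Complex.re h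
  have hi := congrArg Complex.im h
  simp only [pow_two, Complex.add_re, Complex.add_im, Complex.mul_re, Complex.mul_im] at hr hi
  apply Real.le_sqrt_of_sq_le
  rw [sq_abs]
  by_contra hc
  have hlt : τ₁.im ^ 2 + τ₂.im ^ 2 < z.im ^ 2 := not_le.mp hc
  have ha : τ₁.re ^ 2 + τ₂.re ^ 2 < z.re ^ 2 := by nlinarith
  have hdot : τ₁.re * τ₁.im + τ₂.re * τ₂.im = z.re * z.im := by linarith
  have hmul : (τ₁.re ^ 2 + τ₂.re ^ 2) * (τ₁.im ^ 2 + τ₂.im ^ 2) < z.re ^ 2 * z.im ^ 2 :=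
    mul_lt_mul'' ha hlt (by positivity) (by positivity)
  have hcs : (τ₁.re * τ₁.im + τ₂.re * τ₂.im) ^ 2 ≤
      (τ₁.re ^ 2 + τ₂.re ^ 2) * (τ₁.im ^ 2 + τ₂.im ^ 2) := by
    nlinarith [sq_nonneg (τ₁.re * τ₂.im - τ₂.re * τ₁.im)]
  rw [hdot, mul_pow] at hcs
  linarith
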